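/- Any solution (u_h, E_h, B_h, p_h, r_h) of the finite element scheme (Problem 1) satisfies the discrete energy identity R_e^{-1}‖∇u_h‖² + S‖j_h‖² = ⟨f, u_h⟩ and the energy estimate ½ R_e^{-1}‖∇u_h‖² + S‖j_h‖² ≤ (R_e/2)‖f‖_{-1}², where j_h = E_h + u_h × B_h and ‖f‖_{-1} = sup_{0≠v∈H_0^1(Ω)³} ⟨f, v⟩/‖∇v‖. -/

import Mathlib

open scoped RealInnerProductSpace
open Filter Topology

noncomputable section

/-- Abstract functional-analytic model of the relevant function spaces on a
bounded contractible Lipschitz polyhedron `Ω ⊂ ℝ³`.  The Hilbert space `H`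
plays the role of `L²(Ω)³` (vector fields), `S` of `L²(Ω)` (scalar fields) and
`G` of `L²(Ω)^{3×3}` (matrix fields, the targets of the gradient of a vector
field).  The structure carries the `L³`, `L⁶`, `L^∞` and `H^s` norms, the weak
differential operators, the pointwise cross product, the convection form and
the various Sobolev subspaces used in the paper. -/
structure OmegaSetting where
  H : Type
  S : Type
  G : Type
  [nH : NormedAddCommGroup H]
  [iH : InnerProductSpace ℝ H]
  [nS : NormedAddCommGroup S]
  [iS : InnerProductSpace ℝ S]
  [nG : NormedAddCommGroup G]
  [iG : InnerProductSpace ℝ G]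
  /-- the `L³(Ω)` norm of a vector field -/
  norm3 : H → ℝ
  norm3_nonneg : ∀ x, 0 ≤ norm3 x
  /-- the `L⁶(Ω)` norm of a vector field -/
  norm6 : H → ℝ
  norm6_nonneg : ∀ x, 0 ≤ norm6 x
  /-- the `L^∞(Ω)` norm of a vector field -/
  normInf : H → ℝ
  normInf_nonneg : ∀ x, 0 ≤ normInf x
  /-- the `H^s(Ω)³` Sobolev norm of a vector field -/
  sobolevNorm : ℝ → H → ℝ
  sobolevNorm_nonneg : ∀ s x, 0 ≤ sobolevNorm s x
  /-- membership of a vector field in `H^s(Ω)³` -/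
  memSobolev : ℝ → H → Prop
  /-- membership of a scalar field in `H^s(Ω)` -/
  memSobolevS : ℝ → S → Prop
  /-- the weak (distributional) curl operator -/
  curl : H →ₗ[ℝ] H
  /-- the weak (distributional) divergence operator -/
  dive : H →ₗ[ℝ] S
  /-- the weak gradient of a vector field -/
  grad : H →ₗ[ℝ] G
  /-- the pointwise cross product of vector fields -/
  cross : H →ₗ[ℝ] H →ₗ[ℝ] H
  cross_antisymm : ∀ a b, cross a b = - cross b a
  /-- the scalar triple product identity `(a × b, c) = (b, c × a)` in `L²(Ω)` -/
  cross_triple : ∀ a b c, ⟪cross a b, c⟫ = ⟪b, cross c a⟫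
  /-- the convection form: `conv w u v` stands for `((w·∇)u, v)` -/
  conv : H → H → H → ℝ
  /-- `H(curl, Ω)` -/
  Hcurl : Submodule ℝ H
  /-- `H₀(curl, Ω)` (vanishing tangential trace) -/
  Hcurl0 : Submodule ℝ H
  Hcurl0_le : Hcurl0 ≤ Hcurl
  /-- `H(div, Ω)` -/
  Hdiv : Submodule ℝ H
  /-- `H₀(div, Ω)` (vanishing normal trace) -/
  Hdiv0 : Submodule ℝ H
  Hdiv0_le : Hdiv0 ≤ Hdiv
  /-- `H¹₀(Ω)³` -/
  H10 : Submodule ℝ H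
  /-- `L²₀(Ω)`, the mean-value-free scalar fields -/
  L20 : Submodule ℝ S

attribute [instance] OmegaSetting.nH OmegaSetting.iH OmegaSetting.nS
  OmegaSetting.iS OmegaSetting.nG OmegaSetting.iG

/-- the trilinear convection form `L(w; u, v) = ½[((w·∇)u, v) − ((w·∇)v, u)]`. -/
def OmegaSetting.Ltri (Ω : OmegaSetting) (w u v : Ω.H) : ℝ :=
  (Ω.conv w u v - Ω.conv w v u) / 2

/-- Finite element spaces on a regular, quasi-uniform triangulation `T_h` of
`Ω` with mesh size `h`:  a stable Stokes pair `V_h × Q_h` for the fluid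
variables together with the spaces `H₀ʰ(curl, Ω)`, `H₀ʰ(div, Ω)`, `L²₀ʰ` from a
single discrete de Rham sequence with homogeneous boundary conditions, with
commuting projections `Π^curl`, `Π^div`, the discrete (weak) curl `∇_h ×` and
the `L²` projection `ℙ` onto `H₀ʰ(curl, Ω)`. -/
structure FESpacesBC (Ω : OmegaSetting) where
  /-- the mesh size -/
  h : ℝ
  h_pos : 0 < h
  /-- the discrete velocity space `V_h ⊂ H¹₀(Ω)³` -/
  Vh : Submodule ℝ Ω.H
  Vh_le : Vh ≤ Ω.H10
  /-- the discrete pressure space `Q_h` -/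
  Qh : Submodule ℝ Ω.S
  Qh_le : Qh ≤ Ω.L20
  /-- `H₀ʰ(curl, Ω)` -/
  HcurlH : Submodule ℝ Ω.H
  HcurlH_le : HcurlH ≤ Ω.Hcurl0
  /-- `H₀ʰ(div, Ω)` -/
  HdivH : Submodule ℝ Ω.H
  HdivH_le : HdivH ≤ Ω.Hdiv0
  /-- `L²₀ʰ` -/
  L2h : Submodule ℝ Ω.S
  L2h_le : L2h ≤ Ω.L20
  [findimV : FiniteDimensional ℝ Vh]
  [findimQ : FiniteDimensional ℝ Qh]
  [findimC : FiniteDimensional ℝ HcurlH]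
  [findimD : FiniteDimensional ℝ HdivH]
  [findimL : FiniteDimensional ℝ L2h]
  /-- complex property: `∇× H₀ʰ(curl) ⊆ H₀ʰ(div)` -/
  curl_maps : ∀ F ∈ HcurlH, Ω.curl F ∈ HdivH
  /-- `∇· H₀ʰ(div) ⊆ L²₀ʰ` -/
  div_maps : ∀ C ∈ HdivH, Ω.dive C ∈ L2h
  /-- exactness: `∇· H₀ʰ(div, Ω) = L²₀ʰ` -/
  div_surj : ∀ s ∈ L2h, ∃ C ∈ HdivH, Ω.dive C = s
  /-- the discrete (weak) curl operator `∇_h ×` -/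
  dcurl : Ω.H →ₗ[ℝ] Ω.H
  dcurl_mem : ∀ C ∈ HdivH, dcurl C ∈ HcurlH
  /-- `(∇_h × C, F) = (C, ∇ × F)` for all `F ∈ H₀ʰ(curl, Ω)` -/
  dcurl_spec : ∀ C ∈ HdivH, ∀ F ∈ HcurlH, ⟪dcurl C, F⟫ = ⟪C, Ω.curl F⟫
  /-- the commuting projection `Π^curl` -/
  Pcurl : Ω.H →ₗ[ℝ] Ω.H
  Pcurl_mem : ∀ x, Pcurl x ∈ HcurlH
  Pcurl_proj : ∀ x ∈ HcurlH, Pcurl x = x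
  /-- the commuting projection `Π^div` -/
  Pdiv : Ω.H →ₗ[ℝ] Ω.H
  Pdiv_mem : ∀ x, Pdiv x ∈ HdivH
  Pdiv_proj : ∀ x ∈ HdivH, Pdiv x = x
  /-- commutativity of the diagram: `Π^div (∇ × x) = ∇ × (Π^curl x)` -/
  proj_comm : ∀ x, Pdiv (Ω.curl x) = Ω.curl (Pcurl x)
  /-- the `L²` projection `ℙ` onto `H₀ʰ(curl, Ω)` -/
  P : Ω.H →ₗ[ℝ] Ω.H
  P_mem : ∀ x, P x ∈ HcurlH
  P_spec : ∀ x, ∀ F ∈ HcurlH, ⟪P x, F⟫ = ⟪x, F⟫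

/-- the product norm `‖(u, B)‖_W` on `W_h = V_h × H₀ʰ(div, Ω)`:
`‖(u,B)‖_W² = ‖u‖₁² + ‖B‖_d²` with `‖B‖_d² = ‖B‖² + ‖∇·B‖² + ‖∇_h×B‖²`. -/
def normW (Ω : OmegaSetting) (Th : FESpacesBC Ω) (u B : Ω.H) : ℝ :=
  Real.sqrt (‖u‖ ^ 2 + ‖Ω.grad u‖ ^ 2 + ‖B‖ ^ 2 + ‖Ω.dive B‖ ^ 2
    + ‖Th.dcurl B‖ ^ 2)

/-- the product norm `‖(q, s)‖_Y` on `Y_h = Q_h × L²₀ʰ`. -/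
def normY (Ω : OmegaSetting) (q s : Ω.S) : ℝ :=
  Real.sqrt (‖q‖ ^ 2 + ‖s‖ ^ 2)

/-- the norm `‖(v, F, C)‖_X` on `X_h`, relative to a given field `B⁻`:
`‖(v,F,C)‖_X² = ‖v‖² + ‖∇v‖² + ‖∇×F‖² + ‖F + v×B⁻‖² + ‖C‖² + ‖∇·C‖²`. -/
def normX (Ω : OmegaSetting) (Bprev v F C : Ω.H) : ℝ :=
  Real.sqrt (‖v‖ ^ 2 + ‖Ω.grad v‖ ^ 2 + ‖Ω.curl F‖ ^ 2
    + ‖F + Ω.cross v Bprev‖ ^ 2 + ‖C‖ ^ 2 + ‖Ω.dive C‖ ^ 2)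

/-- the trilinear form `a_s(ψ; ξ, η)` of the reduced mixed formulation, with
`ψ = (w, G)`, `ξ = (u, B)`, `η = (v, C)` and `α = S·R_m⁻¹`. -/
def aS (Ω : OmegaSetting) (Th : FESpacesBC Ω) (Re Rm Sc : ℝ)
    (w Gm u Bm v Cm : Ω.H) : ℝ :=
  Ω.Ltri w u v + Re⁻¹ * ⟪Ω.grad u, Ω.grad v⟫
    - (Sc / Rm) * ⟪Th.dcurl Bm, Ω.cross Gm v⟫
    + Sc * ⟪Ω.cross u Gm - Th.P (Ω.cross u Gm),
            Ω.cross v Gm - Th.P (Ω.cross v Gm)⟫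
    - (Sc / Rm) * ⟪Ω.cross u Gm, Th.dcurl Cm⟫
    + (Sc / Rm ^ 2) * ⟪Th.dcurl Bm, Th.dcurl Cm⟫

/-- the bilinear form `b_s((v, C), (q, s)) = −(∇·v, q) + (∇·C, s)`. -/
def bS (Ω : OmegaSetting) (v Cm : Ω.H) (q s : Ω.S) : ℝ :=
  - ⟪Ω.dive v, q⟫ + ⟪Ω.dive Cm, s⟫

/-- the bilinear form `a_{s,L}(U, V)` of one linearized (Picard) step, with
`U = (u, E, B)`, `V = (v, F, C)` and given `(u⁻, B⁻)`. -/
def aSL (Ω : OmegaSetting) (Re Rm Sc : ℝ) (uprev Bprev : Ω.H)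
    (u E Bm v F Cm : Ω.H) : ℝ :=
  (1 / 2) * Ω.Ltri uprev u v + Re⁻¹ * ⟪Ω.grad u, Ω.grad v⟫
    + Sc * ⟪E + Ω.cross u Bprev, F + Ω.cross v Bprev⟫
    - (Sc / Rm) * ⟪Bm, Ω.curl F⟫
    + (Sc / Rm) * ⟪Ω.curl E, Cm⟫

/-- Problem 1: the `B`–`E` based finite element scheme for the stationary MHD
system with boundary conditions `u = 0`, `B·n = 0`, `E×n = 0`, with
`j_h = E_h + u_h × B_h` and `α = S·R_m⁻¹`. -/
structure IsProblem1Solution (Ω : OmegaSetting) (Th : FESpacesBC Ω)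
    (Re Rm Sc : ℝ) (f : Ω.H →ₗ[ℝ] ℝ) (u E B : Ω.H) (p r : Ω.S) : Prop where
  hu : u ∈ Th.Vh
  hE : E ∈ Th.HcurlH
  hB : B ∈ Th.HdivH
  hp : p ∈ Th.Qh
  hr : r ∈ Th.L2h
  momentum : ∀ v ∈ Th.Vh,
    Ω.Ltri u u v + Re⁻¹ * ⟪Ω.grad u, Ω.grad v⟫
      - Sc * ⟪Ω.cross (E + Ω.cross u B) B, v⟫ - ⟪p, Ω.dive v⟫ = f v
  ohm : ∀ F ∈ Th.HcurlH,
    Sc * ⟪E + Ω.cross u B, F⟫ - (Sc / Rm) * ⟪B, Ω.curl F⟫ = 0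
  faraday : ∀ C ∈ Th.HdivH,
    (Sc / Rm) * ⟪Ω.curl E, C⟫ + ⟪r, Ω.dive C⟫ = 0
  incomp : ∀ q ∈ Th.Qh, ⟪Ω.dive u, q⟫ = 0
  gauss : ∀ s ∈ Th.L2h, ⟪Ω.dive B, s⟫ = 0

/-- One step of the Picard iteration (Algorithm 1) for Problem 1: given
`(u⁻, B⁻) = (uprev, Bprev)`, find `(u, E, B, p, r)`, where
`j = E + u × B⁻`. -/
structure IsPicardStep (Ω : OmegaSetting) (Th : FESpacesBC Ω)
    (Re Rm Sc : ℝ) (f : Ω.H →ₗ[ℝ] ℝ) (uprev Bprev : Ω.H)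
    (u E B : Ω.H) (p r : Ω.S) : Prop where
  hu : u ∈ Th.Vh
  hE : E ∈ Th.HcurlH
  hB : B ∈ Th.HdivH
  hp : p ∈ Th.Qh
  hr : r ∈ Th.L2h
  momentum : ∀ v ∈ Th.Vh,
    Ω.Ltri uprev u v + Re⁻¹ * ⟪Ω.grad u, Ω.grad v⟫
      - Sc * ⟪Ω.cross (E + Ω.cross u Bprev) Bprev, v⟫
      - ⟪p, Ω.dive v⟫ = f v
  ohm : ∀ F ∈ Th.HcurlH,
    Sc * ⟪E + Ω.cross u Bprev, F⟫ - (Sc / Rm) * ⟪B, Ω.curl F⟫ = 0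
  faraday : ∀ C ∈ Th.HdivH,
    (Sc / Rm) * ⟪Ω.curl E, C⟫ + ⟪r, Ω.dive C⟫ = 0
  incomp : ∀ q ∈ Th.Qh, ⟪Ω.dive u, q⟫ = 0
  gauss : ∀ s ∈ Th.L2h, ⟪Ω.dive B, s⟫ = 0

/-- Problem 3: the augmented finite element scheme without magnetic Lagrange
multiplier, with the augmentation term `α(∇·B_h, ∇·C)`. -/
structure IsProblem3Solution (Ω : OmegaSetting) (Th : FESpacesBC Ω)
    (Re Rm Sc : ℝ) (f : Ω.H →ₗ[ℝ] ℝ) (u E B : Ω.H) (p : Ω.S) : Prop where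
  hu : u ∈ Th.Vh
  hE : E ∈ Th.HcurlH
  hB : B ∈ Th.HdivH
  hp : p ∈ Th.Qh
  momentum : ∀ v ∈ Th.Vh,
    Ω.Ltri u u v + Re⁻¹ * ⟪Ω.grad u, Ω.grad v⟫
      - Sc * ⟪Ω.cross (E + Ω.cross u B) B, v⟫ - ⟪p, Ω.dive v⟫ = f v
  ohm : ∀ F ∈ Th.HcurlH,
    Sc * ⟪E + Ω.cross u B, F⟫ - (Sc / Rm) * ⟪B, Ω.curl F⟫ = 0
  faraday : ∀ C ∈ Th.HdivH,
    (Sc / Rm) * ⟪Ω.curl E, C⟫ + (Sc / Rm) * ⟪Ω.dive B, Ω.dive C⟫ = 0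
  incomp : ∀ q ∈ Th.Qh, ⟪Ω.dive u, q⟫ = 0

/-- One step of the Picard iteration for the augmented scheme without
magnetic Lagrange multiplier, with `jⁿ_{n−1} = Eⁿ + uⁿ × B^{n−1}`. -/
structure IsPicardStep3 (Ω : OmegaSetting) (Th : FESpacesBC Ω)
    (Re Rm Sc : ℝ) (f : Ω.H →ₗ[ℝ] ℝ) (uprev Bprev : Ω.H)
    (u E B : Ω.H) (p : Ω.S) : Prop where
  hu : u ∈ Th.Vh
  hE : E ∈ Th.HcurlH
  hB : B ∈ Th.HdivH
  hp : p ∈ Th.Qh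
  momentum : ∀ v ∈ Th.Vh,
    Ω.Ltri uprev u v + Re⁻¹ * ⟪Ω.grad u, Ω.grad v⟫
      - Sc * ⟪Ω.cross (E + Ω.cross u Bprev) Bprev, v⟫
      - ⟪p, Ω.dive v⟫ = f v
  ohm : ∀ F ∈ Th.HcurlH,
    Sc * ⟪E + Ω.cross u Bprev, F⟫ - (Sc / Rm) * ⟪B, Ω.curl F⟫ = 0
  faraday : ∀ C ∈ Th.HdivH,
    (Sc / Rm) * ⟪Ω.curl E, C⟫ + (Sc / Rm) * ⟪Ω.dive B, Ω.dive C⟫ = 0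
  incomp : ∀ q ∈ Th.Qh, ⟪Ω.dive u, q⟫ = 0

/-- The exact (weak) solution of the stationary MHD system with boundary
conditions `u = 0`, `B·n = 0`, `E×n = 0`, with `j = E + u × B = R_m⁻¹ ∇×B`. -/
structure IsExactSolutionBC (Ω : OmegaSetting) (Re Rm Sc : ℝ)
    (f : Ω.H →ₗ[ℝ] ℝ) (u E B : Ω.H) (p : Ω.S) : Prop where
  hu : u ∈ Ω.H10
  hE : E ∈ Ω.Hcurl0
  hB : B ∈ Ω.Hdiv0
  hp : p ∈ Ω.L20
  momentum : ∀ v ∈ Ω.H10,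
    Ω.Ltri u u v + Re⁻¹ * ⟪Ω.grad u, Ω.grad v⟫
      - Sc * ⟪Ω.cross (E + Ω.cross u B) B, v⟫ - ⟪p, Ω.dive v⟫ = f v
  ohm : E + Ω.cross u B = Rm⁻¹ • Ω.curl B
  faraday : Ω.curl E = 0
  gauss : Ω.dive B = 0
  incomp : Ω.dive u = 0

/-- The (minimal) regularity assumption (4.1) of the paper:
`u ∈ H^{1+σ}(Ω)³`, `B, ∇×B, E ∈ H^σ(Ω)³`, `p ∈ H^σ(Ω) ∩ L²₀(Ω)`, `σ > 1/2`. -/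
def RegularityAssumption (Ω : OmegaSetting) (σ : ℝ)
    (u E B : Ω.H) (p : Ω.S) : Prop :=
  1 / 2 < σ ∧ Ω.memSobolev (1 + σ) u ∧ Ω.memSobolev σ B ∧
    Ω.memSobolev σ (Ω.curl B) ∧ Ω.memSobolev σ E ∧
    Ω.memSobolevS σ p ∧ p ∈ Ω.L20

/-- The work of the Lorentz force `j × B` on `u` is opposite to the pairing of `j` with the
electromotive field `u × B`. -/
theorem OmegaSetting.inner_lorentz_force (Ω : OmegaSetting) (j B u : Ω.H) :
    ⟪Ω.cross j B, u⟫ = -⟪j, Ω.cross u B⟫ := by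
  rw [Ω.cross_triple, Ω.cross_antisymm u j, inner_neg_right, ← Ω.cross_triple, real_inner_comm]

/-- **Theorem (discrete energy law for Problem 1).**
Any solution of the `B`–`E` scheme satisfies
`R_e⁻¹‖∇u_h‖² + S‖j_h‖² = ⟨f, u_h⟩` and
`½R_e⁻¹‖∇u_h‖² + S‖j_h‖² ≤ (R_e/2)‖f‖₋₁²`, where `j_h = E_h + u_h × B_h`. -/
theorem problem1_energy_law (Ω : OmegaSetting) (Th : FESpacesBC Ω)
    (Re Rm Sc : ℝ) (hRe : 0 < Re) (hRm : 0 < Rm) (hSc : 0 < Sc)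
    (f : Ω.H →ₗ[ℝ] ℝ) (fneg1 : ℝ) (hfneg1 : 0 ≤ fneg1)
    (hf : ∀ v ∈ Ω.H10, f v ≤ fneg1 * ‖Ω.grad v‖)
    (u E B : Ω.H) (p r : Ω.S)
    (hsol : IsProblem1Solution Ω Th Re Rm Sc f u E B p r) :
    Re⁻¹ * ‖Ω.grad u‖ ^ 2 + Sc * ‖E + Ω.cross u B‖ ^ 2 = f u ∧
    (1 / 2) * Re⁻¹ * ‖Ω.grad u‖ ^ 2 + Sc * ‖E + Ω.cross u B‖ ^ 2
      ≤ (Re / 2) * fneg1 ^ 2 := by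
  set j := E + Ω.cross u B with hj
  have hconv : Ω.Ltri u u u = 0 := by simp [OmegaSetting.Ltri]
  have hincomp : ⟪p, Ω.dive u⟫ = 0 := by
    rw [real_inner_comm]; exact hsol.incomp p hsol.hp
  have hgauss : ⟪r, Ω.dive B⟫ = 0 := by
    rw [real_inner_comm]; exact hsol.gauss r hsol.hr
  have hmom := hsol.momentum u hsol.hu
  have hohm := hsol.ohm E hsol.hE
  have hfar := hsol.faraday B hsol.hB
  rw [← hj, hconv, hincomp, real_inner_self_eq_norm_sq, Ω.inner_lorentz_force] at hmom
  rw [← hj] at hohm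
  rw [hgauss, real_inner_comm] at hfar
  have hsplit : ‖j‖ ^ 2 = ⟪j, E⟫ + ⟪j, Ω.cross u B⟫ := by
    rw [← real_inner_self_eq_norm_sq, ← inner_add_right, ← hj]
  have henergy : Re⁻¹ * ‖Ω.grad u‖ ^ 2 + Sc * ‖j‖ ^ 2 = f u := by
    rw [hsplit]; linarith
  refine ⟨henergy, ?_⟩
  have hyoung : fneg1 * ‖Ω.grad u‖ ≤ (Re / 2) * fneg1 ^ 2 + (1 / 2) * Re⁻¹ * ‖Ω.grad u‖ ^ 2 := by
    have hsq : (Re / 2) * fneg1 ^ 2 + (1 / 2) * Re⁻¹ * ‖Ω.grad u‖ ^ 2 - fneg1 * ‖Ω.grad u‖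
        = (Re / 2) * (fneg1 - Re⁻¹ * ‖Ω.grad u‖) ^ 2 := by
      field_simp
      ring
    have : 0 ≤ (Re / 2) * (fneg1 - Re⁻¹ * ‖Ω.grad u‖) ^ 2 := by positivity
    linarith
  linarith [hf u (Th.Vh_le hsol.hu)]
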